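/- Let n ≥ 1 and j ∈ {1,…,n}. There exist constants C > 0 and c > 0 such that for all x, y ∈ ℝⁿ and all t > 0, |Ω_j(x,y,t)| ≤ C t² e^{-c(|x-y|² + |y| |x-y|)} / (t+|x-y|)^{n+2}. -/

import Mathlib

open Real MeasureTheory Set

/-- The Mehler (Hermite heat) kernel on ℝⁿ. -/
noncomputable def W (n : ℕ) (s : ℝ) (x y : EuclideanSpace ℝ (Fin n)) : ℝ :=
  (Real.exp (-2 * s) / (Real.pi * (1 - Real.exp (-4 * s)))) ^ ((n : ℝ) / 2) *
    Real.exp (-(1 / 4) * ((1 + Real.exp (-2 * s)) / (1 - Real.exp (-2 * s)) * ‖x - y‖ ^ 2 +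
      (1 - Real.exp (-2 * s)) / (1 + Real.exp (-2 * s)) * ‖x + y‖ ^ 2))

/-- A_{j,s}(x,y) = (∂_{x_j} + x_j) W_s(x,y). -/
noncomputable def A (n : ℕ) (j : Fin n) (s : ℝ) (x y : EuclideanSpace ℝ (Fin n)) : ℝ :=
  (x j - 1 / 2 * ((1 + Real.exp (-2 * s)) / (1 - Real.exp (-2 * s))) * (x j - y j) -
    1 / 2 * ((1 - Real.exp (-2 * s)) / (1 + Real.exp (-2 * s))) * (x j + y j)) * W n s x y

/-- Ω_j(x,y,t) = t (∂_{x_j} + x_j) P_t^L(x,y), where P_t^L is the Hermite-Poisson kernel. -/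
noncomputable def Omj (n : ℕ) (j : Fin n) (x y : EuclideanSpace ℝ (Fin n)) (t : ℝ) : ℝ :=
  t ^ 2 / Real.sqrt (4 * Real.pi) *
    ∫ s in Set.Ioi (0 : ℝ), s ^ (-(3 : ℝ) / 2) * Real.exp (-t ^ 2 / (4 * s)) * A n j s x y

/-- `(1 - e^{-2s}) / (1 + e^{-2s})` is the hyperbolic tangent of `s`. -/
theorem one_sub_exp_div_one_add_exp (s : ℝ) :
    (1 - exp (-2 * s)) / (1 + exp (-2 * s)) = sinh s / cosh s := by
  have h1 : exp (-2 * s) = exp (-s) * exp (-s) := by rw [← exp_add]; ring_nf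
  have h2 : exp s * exp (-s) = 1 := by rw [← exp_add]; simp
  have h3 := exp_pos s
  have h4 := exp_pos (-s)
  rw [h1, sinh_eq, cosh_eq, div_eq_div_iff (by positivity) (by positivity)]
  linear_combination (-exp (-s)) * h2

theorem exp_div_one_sub_exp (s : ℝ) (hs : 0 < s) :
    exp (-2 * s) / (π * (1 - exp (-4 * s))) = 1 / (4 * π * (sinh s * cosh s)) := by
  have h1 : exp (-2 * s) = exp (-s) ^ 2 := by rw [← exp_nat_mul]; norm_num
  have h1' : exp (-4 * s) = exp (-s) ^ 4 := by rw [← exp_nat_mul]; norm_num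
  have h2 : exp s * exp (-s) = 1 := by rw [← exp_add]; simp
  have h3 := exp_pos s
  have h4 := exp_pos (-s)
  have h5 : 0 < sinh s := sinh_pos_iff.2 hs
  have h6 : 0 < cosh s := cosh_pos s
  have h7 : 0 < 1 - exp (-4 * s) := by
    have : exp (-4 * s) < 1 := exp_lt_one_iff.2 (by linarith)
    linarith
  have h8 := pi_pos
  rw [div_eq_div_iff (by positivity) (by positivity), h1, h1', sinh_eq, cosh_eq]
  linear_combination (π * (exp s * exp (-s) + 1)) * h2

/-- The normalising factor of the Mehler kernel, together with the loss of a square root of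
`tanh s` from one derivative, is controlled by the Euclidean one. -/
theorem mehler_factor_le (n : ℕ) (hn : 1 ≤ n) (s : ℝ) (hs : 0 < s) :
    (exp (-2 * s) / (π * (1 - exp (-4 * s)))) ^ ((n : ℝ) / 2) / √(sinh s / cosh s) ≤
      s ^ (-((n : ℝ) + 1) / 2) := by
  obtain ⟨m, rfl⟩ : ∃ m, n = m + 1 := ⟨n - 1, by omega⟩
  have hS : s ≤ sinh s := self_le_sinh_iff.2 hs.le
  have hC : 1 ≤ cosh s := one_le_cosh s
  have hS0 : 0 < sinh s := hs.trans_le hS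
  have hC0 : 0 < cosh s := by linarith
  have hpi := pi_gt_three
  rw [exp_div_one_sub_exp s hs]
  set u := 1 / (4 * π * (sinh s * cosh s)) with hu
  have hu0 : 0 < u := by positivity
  have hu1 : u ≤ s⁻¹ := by
    rw [hu, one_div]
    gcongr
    have : s * 1 ≤ sinh s * cosh s := by gcongr
    nlinarith [mul_pos hS0 hC0]
  have hu2 : √u / √(sinh s / cosh s) ≤ s⁻¹ := by
    rw [← sqrt_div hu0.le]
    apply sqrt_le_iff.2 ⟨by positivity, ?_⟩
    have : u / (sinh s / cosh s) = (4 * π * sinh s ^ 2)⁻¹ := by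
      rw [hu]; field_simp
    rw [this, inv_pow]
    gcongr
    have : s ^ 2 ≤ sinh s ^ 2 := by gcongr
    nlinarith [sq_nonneg (sinh s)]
  have hpow : u ^ (((m + 1 : ℕ) : ℝ) / 2) = u ^ ((m : ℝ) / 2) * √u := by
    rw [sqrt_eq_rpow, ← rpow_add hu0]; push_cast; ring_nf
  have hs' : s ^ (-(((m + 1 : ℕ) : ℝ) + 1) / 2) = (s⁻¹) ^ ((m : ℝ) / 2) * s⁻¹ := by
    rw [inv_rpow hs.le, ← rpow_neg hs.le, ← rpow_neg_one s, ← rpow_add hs]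
    push_cast; ring_nf
  rw [hpow, hs', mul_div_assoc]
  gcongr

/-- The linear factor is absorbed by the Gaussian, leaving enough decay for the Euclidean heat
kernel and for the factor `exp (-c (r² + |y| r))`. -/
theorem linear_mul_gaussian_le {a s r M Y : ℝ} (ha : 0 < a) (ha1 : a ≤ 1) (has : a ≤ 2 * s)
    (hr : 0 ≤ r) (hY : 2 * Y ≤ M + r) :
    (1 / 2 * (r / a + M)) * exp (-(1 / 4) * (a⁻¹ * r ^ 2 + a * M ^ 2)) ≤
      (√a)⁻¹ * (exp (-(r ^ 2 / (32 * s))) * exp (-(1 / 64) * (r ^ 2 + Y * r))) := by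
  have hs : 0 < s := by linarith
  have hb : 0 < √a := sqrt_pos.2 ha
  have hbb : √a ^ 2 = a := sq_sqrt ha.le
  set b := √a
  rw [← hbb]
  have hlin : 1 / 2 * (r / b ^ 2 + M) ≤
      b⁻¹ * exp (1 / 8 * ((b ^ 2)⁻¹ * r ^ 2 + b ^ 2 * M ^ 2)) := by
    have h1 : 1 / 2 * (r / b ^ 2 + M) = b⁻¹ * (1 / 2 * (r / b + b * M)) := by field_simp
    have h2 : (b ^ 2)⁻¹ * r ^ 2 + b ^ 2 * M ^ 2 = (r / b) ^ 2 + (b * M) ^ 2 := by field_simp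
    rw [h1, h2]
    gcongr
    refine le_trans ?_ (add_one_le_exp _)
    nlinarith [sq_nonneg (r / b - 2), sq_nonneg (b * M - 2)]
  have hE1 : r ^ 2 / (2 * s) ≤ (b ^ 2)⁻¹ * r ^ 2 := by
    rw [div_eq_inv_mul, hbb]; gcongr
  have hE2 : r ^ 2 ≤ (b ^ 2)⁻¹ * r ^ 2 := by
    have : 1 ≤ (b ^ 2)⁻¹ := by rw [hbb]; exact (one_le_inv₀ ha).2 ha1
    nlinarith [sq_nonneg r]
  have hE3 : 2 * (r * M) ≤ (b ^ 2)⁻¹ * r ^ 2 + b ^ 2 * M ^ 2 := by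
    have h2 : (b ^ 2)⁻¹ * r ^ 2 + b ^ 2 * M ^ 2 = (r / b) ^ 2 + (b * M) ^ 2 := by field_simp
    have h3 : r * M = (r / b) * (b * M) := by field_simp
    rw [h2, h3]
    nlinarith [sq_nonneg (r / b - b * M)]
  have hbM : 0 ≤ b ^ 2 * M ^ 2 := by positivity
  have hYr : 2 * (Y * r) ≤ M * r + r ^ 2 := by nlinarith
  have hrs : r ^ 2 / (32 * s) = 1 / 16 * (r ^ 2 / (2 * s)) := by ring
  refine (mul_le_mul_of_nonneg_right hlin (exp_pos _).le).trans ?_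
  rw [mul_assoc, ← exp_add, ← exp_add, hrs]
  refine mul_le_mul_of_nonneg_left (exp_le_exp.2 ?_) (by positivity)
  nlinarith

theorem abs_A_le (n : ℕ) (hn : 1 ≤ n) (j : Fin n) (s : ℝ) (hs : 0 < s)
    (x y : EuclideanSpace ℝ (Fin n)) :
    |A n j s x y| ≤ s ^ (-((n : ℝ) + 1) / 2) *
      (exp (-(‖x - y‖ ^ 2 / (32 * s))) *
        exp (-(1 / 64) * (‖x - y‖ ^ 2 + ‖y‖ * ‖x - y‖))) := by
  have hfac := mehler_factor_le n hn s hs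
  have hq : exp (-2 * s) < 1 := exp_lt_one_iff.2 (by linarith)
  have hq0 : 0 < exp (-2 * s) := exp_pos _
  have hq1 : 1 - 2 * s ≤ exp (-2 * s) := by linarith [add_one_le_exp (-2 * s)]
  rw [← one_sub_exp_div_one_add_exp] at hfac
  have hinv : (1 + exp (-2 * s)) / (1 - exp (-2 * s)) =
      ((1 - exp (-2 * s)) / (1 + exp (-2 * s)))⁻¹ := by rw [inv_div]
  unfold A W
  rw [hinv]
  set a := (1 - exp (-2 * s)) / (1 + exp (-2 * s)) with hadef
  have ha : 0 < a := div_pos (by linarith) (by linarith)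
  have ha1 : a ≤ 1 := by rw [hadef, div_le_one (by linarith)]; linarith
  have has : a ≤ 2 * s := by rw [hadef, div_le_iff₀ (by linarith)]; nlinarith
  have hY : 2 * ‖y‖ ≤ ‖x + y‖ + ‖x - y‖ := by
    have h := norm_sub_le (x + y) (x - y)
    have h2 : (x + y) - (x - y) = (2 : ℝ) • y := by module
    rw [h2, norm_smul] at h
    simpa using h
  have hgauss := linear_mul_gaussian_le ha ha1 has (norm_nonneg (x - y)) hY
  have hr := PiLp.norm_apply_le (x - y) j
  have hM := PiLp.norm_apply_le (x + y) j
  simp only [PiLp.sub_apply, PiLp.add_apply, Real.norm_eq_abs] at hr hM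
  have hlin : |x j - 1 / 2 * a⁻¹ * (x j - y j) - 1 / 2 * a * (x j + y j)| ≤
      1 / 2 * (‖x - y‖ / a + ‖x + y‖) := by
    have hia : 1 ≤ a⁻¹ := (one_le_inv₀ ha).2 ha1
    have heq : x j - 1 / 2 * a⁻¹ * (x j - y j) - 1 / 2 * a * (x j + y j) =
        1 / 2 * ((1 - a) * (x j + y j) - (a⁻¹ - 1) * (x j - y j)) := by ring
    rw [heq, abs_mul, abs_of_pos (by norm_num : (0 : ℝ) < 1 / 2), div_eq_inv_mul ‖x - y‖ a]
    gcongr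
    refine (abs_sub _ _).trans ?_
    rw [abs_mul, abs_mul, abs_of_nonneg (by linarith : 0 ≤ 1 - a),
      abs_of_nonneg (by linarith : 0 ≤ a⁻¹ - 1)]
    nlinarith [abs_nonneg (x j + y j), abs_nonneg (x j - y j), norm_nonneg (x - y),
      norm_nonneg (x + y)]
  have hu : 0 ≤ (exp (-2 * s) / (π * (1 - exp (-4 * s)))) ^ ((n : ℝ) / 2) := by
    rw [exp_div_one_sub_exp s hs]
    have := sinh_pos_iff.2 hs
    have := cosh_pos s
    positivity
  set u := (exp (-2 * s) / (π * (1 - exp (-4 * s)))) ^ ((n : ℝ) / 2)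
  rw [abs_mul, abs_mul, abs_of_nonneg hu, abs_exp, mul_left_comm]
  calc _ ≤ u * ((1 / 2 * (‖x - y‖ / a + ‖x + y‖)) *
        exp (-(1 / 4) * (a⁻¹ * ‖x - y‖ ^ 2 + a * ‖x + y‖ ^ 2))) := by gcongr
    _ ≤ u * ((√a)⁻¹ * (exp (-(‖x - y‖ ^ 2 / (32 * s))) *
        exp (-(1 / 64) * (‖x - y‖ ^ 2 + ‖y‖ * ‖x - y‖)))) := by gcongr
    _ = (u / √a) * (exp (-(‖x - y‖ ^ 2 / (32 * s))) *
        exp (-(1 / 64) * (‖x - y‖ ^ 2 + ‖y‖ * ‖x - y‖))) := by ring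
    _ ≤ _ := by gcongr

theorem rpow_smul_gamma_integrand_eq {p B s : ℝ} (hs : 0 < s) :
    s ^ ((-1 : ℝ) - 1) • ((s ^ (-1 : ℝ)) ^ (p - 1) * exp (-(B * s ^ (-1 : ℝ)))) =
      s ^ (-(p + 1)) * exp (-(B / s)) := by
  rw [← rpow_mul hs.le, smul_eq_mul, ← mul_assoc, ← rpow_add hs, rpow_neg_one, div_eq_mul_inv]
  ring_nf

theorem integrableOn_rpow_mul_exp_neg_div {p B : ℝ} (hp : 0 < p) (hB : 0 < B) :
    IntegrableOn (fun s : ℝ => s ^ (-(p + 1)) * exp (-(B / s))) (Ioi 0) := by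
  have h : IntegrableOn (fun u : ℝ => u ^ (p - 1) * exp (-(B * u))) (Ioi 0) := by
    have := integrableOn_rpow_mul_exp_neg_mul_rpow (s := p - 1) (p := 1) (b := B)
      (by linarith) one_pos hB
    simpa using this
  rw [← integrableOn_Ioi_comp_rpow_iff _ (p := -1) (by norm_num)] at h
  refine h.congr_fun (fun s hs => ?_) measurableSet_Ioi
  simp only [abs_neg, abs_one, one_mul]
  exact rpow_smul_gamma_integrand_eq hs

theorem integral_rpow_mul_exp_neg_div {p B : ℝ} (hp : 0 < p) (hB : 0 < B) :
    ∫ s in Ioi (0 : ℝ), s ^ (-(p + 1)) * exp (-(B / s)) = (1 / B) ^ p * Gamma p := by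
  rw [← integral_rpow_mul_exp_neg_mul_Ioi hp hB,
    ← integral_comp_rpow_Ioi (fun u => u ^ (p - 1) * exp (-(B * u))) (p := -1) (by norm_num)]
  refine setIntegral_congr_fun measurableSet_Ioi fun s hs => ?_
  simp only [abs_neg, abs_one, one_mul]
  exact (rpow_smul_gamma_integrand_eq hs).symm

theorem rpow_half_eq_pow (n : ℕ) {d : ℝ} (hd : 0 < d) :
    (1 / (1 / 128 * d ^ 2)) ^ (((n : ℝ) + 2) / 2) =
      (128 : ℝ) ^ (((n : ℝ) + 2) / 2) / d ^ (n + 2) := by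
  have h : (1 / (1 / 128 * d ^ 2)) = 128 / d ^ 2 := by field_simp
  rw [h, div_rpow (by norm_num) (by positivity), ← rpow_natCast d 2, ← rpow_mul hd.le,
    ← rpow_natCast d (n + 2)]
  congr 2
  push_cast
  ring

theorem Omj_pointwise_bound (n : ℕ) (hn : 1 ≤ n) (j : Fin n) :
    ∃ C > (0 : ℝ), ∃ c > (0 : ℝ), ∀ (x y : EuclideanSpace ℝ (Fin n)) (t : ℝ), 0 < t →
      |Omj n j x y t| ≤
        C * t ^ 2 * Real.exp (-c * (‖x - y‖ ^ 2 + ‖y‖ * ‖x - y‖)) /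
          (t + ‖x - y‖) ^ (n + 2) := by
  set G : ℝ := (128 : ℝ) ^ (((n : ℝ) + 2) / 2) * Gamma (((n : ℝ) + 2) / 2)
  have hp : 0 < ((n : ℝ) + 2) / 2 := by positivity
  have hG : 0 < G := mul_pos (by positivity) (Gamma_pos_of_pos hp)
  have hpi : 0 < √(4 * π) := by positivity
  refine ⟨G / √(4 * π), by positivity, 1 / 64, by norm_num, fun x y t ht => ?_⟩
  set r := ‖x - y‖
  have hr : 0 ≤ r := norm_nonneg _
  have hd : 0 < t + r := by positivity
  set D := exp (-(1 / 64) * (r ^ 2 + ‖y‖ * r))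
  have hB : 0 < 1 / 128 * (t + r) ^ 2 := by positivity
  have hbound : ∀ s ∈ Ioi (0 : ℝ),
      ‖s ^ (-(3 : ℝ) / 2) * exp (-t ^ 2 / (4 * s)) * A n j s x y‖ ≤
        D * (s ^ (-(((n : ℝ) + 2) / 2 + 1)) * exp (-(1 / 128 * (t + r) ^ 2 / s))) := by
    intro s hs
    have hs : 0 < s := hs
    rw [norm_mul, Real.norm_of_nonneg (by positivity), Real.norm_eq_abs]
    refine (mul_le_mul_of_nonneg_left (abs_A_le n hn j s hs x y) (by positivity)).trans ?_
    have h1 : s ^ (-(((n : ℝ) + 2) / 2 + 1)) =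
        s ^ (-(3 : ℝ) / 2) * s ^ (-((n : ℝ) + 1) / 2) := by
      rw [← rpow_add hs]; ring_nf
    have h2 : exp (-t ^ 2 / (4 * s)) * exp (-(r ^ 2 / (32 * s))) ≤
        exp (-(1 / 128 * (t + r) ^ 2 / s)) := by
      rw [← exp_add]
      gcongr
      have : -(1 / 128 * (t + r) ^ 2 / s) - (-t ^ 2 / (4 * s) + -(r ^ 2 / (32 * s))) =
          (32 * t ^ 2 + 4 * r ^ 2 - (t + r) ^ 2) / (128 * s) := by field_simp; ring
      have h3 : 0 ≤ (32 * t ^ 2 + 4 * r ^ 2 - (t + r) ^ 2) / (128 * s) :=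
        div_nonneg (by nlinarith [sq_nonneg (t - r)]) (by positivity)
      linarith
    rw [h1]
    calc _ = D * (s ^ (-(3 : ℝ) / 2) * s ^ (-((n : ℝ) + 1) / 2) *
          (exp (-t ^ 2 / (4 * s)) * exp (-(r ^ 2 / (32 * s))))) := by ring
      _ ≤ _ := by gcongr
  have hint := norm_integral_le_of_norm_le
    ((integrableOn_rpow_mul_exp_neg_div hp hB).const_mul D)
    ((ae_restrict_iff' measurableSet_Ioi).2 (ae_of_all volume hbound))
  rw [integral_const_mul, integral_rpow_mul_exp_neg_div hp hB, rpow_half_eq_pow n hd,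
    Real.norm_eq_abs] at hint
  unfold Omj
  rw [abs_mul, abs_of_nonneg (by positivity)]
  refine (mul_le_mul_of_nonneg_left hint (by positivity)).trans (le_of_eq ?_)
  ring
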